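/- For every integer t ≥ 1 and every n, the 3-graph T_3(n,3)^{t+} is F_5(f_3;t)-free; that is, no 3-graph obtained from T_3(n,3) by adding inside each part a 3-graph in which every pair of vertices lies in at most t−1 hyperedges contains a copy of F_5(f_3;t). -/

import Mathlib

open Finset

/-- `H` (a 3-graph given by its edge set on vertex type `V`) contains a copy of the
3-graph `F` (given by its edge set on vertex type `W`). -/
def HasCopy {V W : Type*} [DecidableEq V] [DecidableEq W]
    (H : Finset (Finset V)) (F : Finset (Finset W)) : Prop :=
  ∃ f : W ↪ V, ∀ e ∈ F, e.image f ∈ H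

/-- The Turán number `ex_3(n, F)`: the maximum number of hyperedges of an `F`-free
3-uniform hypergraph on `n` vertices. -/
noncomputable def exThree {W : Type*} [DecidableEq W] (n : ℕ) (F : Finset (Finset W)) : ℕ :=
  sSup {k | ∃ H : Finset (Finset (Fin n)), (∀ e ∈ H, e.card = 3) ∧ ¬ HasCopy H F ∧ H.card = k}

/-- The `i`-th part of the balanced tripartition of `Fin n` (vertices with residue `i` mod 3);
the parts have sizes `⌊n/3⌋` or `⌈n/3⌉`. -/
def turanPart (n : ℕ) (i : Fin 3) : Finset (Fin n) :=
  Finset.univ.filter (fun v => (v : ℕ) % 3 = (i : ℕ))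

/-- The balanced complete tripartite 3-graph `T_3(n,3)`: hyperedges are exactly the triples
with one vertex in each part of the balanced tripartition. -/
def T3 (n : ℕ) : Finset (Finset (Fin n)) :=
  Finset.univ.filter (fun e => e.card = 3 ∧ ∀ i : Fin 3, (e ∩ turanPart n i).card = 1)

/-- The 3-graph `F_5` on `{f_1, …, f_5}` with hyperedges `f_1f_2f_3, f_1f_2f_4, f_3f_4f_5`. -/
def F5 : Finset (Finset (Fin 5)) := {{0,1,2},{0,1,3},{2,3,4}}

/-- `F_5(f_5;t)`: `F_5` with the vertex `f_5` blown up to `t` copies.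
Here `inl 0, inl 1, inl 2, inl 3` play the roles of `f_1,f_2,f_3,f_4` and the
vertices `inr j` are the `t` copies of `f_5`. -/
def F5b5 (t : ℕ) : Finset (Finset (Fin 4 ⊕ Fin t)) :=
  ({({Sum.inl 0, Sum.inl 1, Sum.inl 2} : Finset (Fin 4 ⊕ Fin t)),
    ({Sum.inl 0, Sum.inl 1, Sum.inl 3} : Finset (Fin 4 ⊕ Fin t))} :
      Finset (Finset (Fin 4 ⊕ Fin t))) ∪
  Finset.univ.image (fun j : Fin t => ({Sum.inl 2, Sum.inl 3, Sum.inr j} : Finset (Fin 4 ⊕ Fin t)))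

/-- `F_5(f_3;t)`: `F_5` with the vertex `f_3` blown up to `t` copies.
Here `inl 0, inl 1, inl 2, inl 3` play the roles of `f_1,f_2,f_4,f_5` and the
vertices `inr j` are the `t` copies of `f_3`. -/
def F5b3 (t : ℕ) : Finset (Finset (Fin 4 ⊕ Fin t)) :=
  ({({Sum.inl 0, Sum.inl 1, Sum.inl 2} : Finset (Fin 4 ⊕ Fin t))} :
      Finset (Finset (Fin 4 ⊕ Fin t))) ∪
  Finset.univ.image (fun j : Fin t => ({Sum.inl 0, Sum.inl 1, Sum.inr j} : Finset (Fin 4 ⊕ Fin t))) ∪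
  Finset.univ.image (fun j : Fin t => ({Sum.inr j, Sum.inl 2, Sum.inl 3} : Finset (Fin 4 ⊕ Fin t)))

/-- `S^t(N)` (the size of `D(N,3,t,2)`): the maximum number of hyperedges of a 3-graph on `N`
vertices in which every pair of vertices is contained in at most `t-1` hyperedges. -/
noncomputable def Dmax (N t : ℕ) : ℕ :=
  sSup {k | ∃ H : Finset (Finset (Fin N)), (∀ e ∈ H, e.card = 3) ∧
    (∀ u v : Fin N, u ≠ v → (H.filter (fun e => u ∈ e ∧ v ∈ e)).card ≤ t - 1) ∧ H.card = k}

/-- `e(T_3(n,3)^{t+})`: the number of hyperedges of `T_3(n,3)` together with a maximum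
3-graph inside each part in which every pair of vertices lies in at most `t-1` hyperedges. -/
noncomputable def eT3plus (n t : ℕ) : ℕ :=
  (T3 n).card + ∑ i : Fin 3, Dmax ((turanPart n i).card) t

/-- `F` is a subgraph of a blow-up of `F_5`: every edge is a triple, and there is a map
to `V(F_5)` that is injective on each edge and sends each edge to an edge of `F_5`. -/
def IsSubBlowupF5 {W : Type*} [DecidableEq W] (F : Finset (Finset W)) : Prop :=
  (∀ e ∈ F, e.card = 3) ∧ ∃ φ : W → Fin 5, ∀ e ∈ F, (e.image φ).card = 3 ∧ e.image φ ∈ F5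

/-- The complete tripartite 3-graph with parts `A`, `B`, `C`: all triples with exactly
one vertex in each of `A`, `B`, `C`. -/
def tripartiteEdges {n : ℕ} (A B C : Finset (Fin n)) : Finset (Finset (Fin n)) :=
  Finset.univ.filter (fun e =>
    (e ∩ A).card = 1 ∧ (e ∩ B).card = 1 ∧ (e ∩ C).card = 1 ∧ e.card = 3)

/-- The complete 3-partite 3-graph `K_{t,s,s}` with parts of sizes `t`, `s`, `s`. -/
def Ktss (t s : ℕ) : Finset (Finset (Fin t ⊕ Fin s ⊕ Fin s)) :=
  Finset.univ.image (fun x : Fin t × Fin s × Fin s =>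
    ({Sum.inl x.1, Sum.inr (Sum.inl x.2.1), Sum.inr (Sum.inr x.2.2)} :
      Finset (Fin t ⊕ Fin s ⊕ Fin s)))

/-- All hyperedges of `H` consist of one vertex of the `A`-side (`Fin mA`) and two
vertices of the `B`-side (`Fin nB`). -/
def BipShape (mA nB : ℕ) (H : Finset (Finset (Fin mA ⊕ Fin nB))) : Prop :=
  ∀ e ∈ H, ∃ a : Fin mA, ∃ b c : Fin nB, b ≠ c ∧
    e = ({Sum.inl a, Sum.inr b, Sum.inr c} : Finset (Fin mA ⊕ Fin nB))

/-- `H` contains a copy of `K_{t,s,s}` whose `t`-vertex part lies on the `A`-side and whose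
two `s`-vertex parts lie on the `B`-side. -/
def HasBipKtss (mA nB t s : ℕ) (H : Finset (Finset (Fin mA ⊕ Fin nB))) : Prop :=
  ∃ (T : Finset (Fin mA)) (S0 S1 : Finset (Fin nB)), T.card = t ∧
    S0.card = s ∧ S1.card = s ∧ Disjoint S0 S1 ∧
    ∀ a ∈ T, ∀ b ∈ S0, ∀ c ∈ S1,
      ({Sum.inl a, Sum.inr b, Sum.inr c} : Finset (Fin mA ⊕ Fin nB)) ∈ H

/-- The bipartite Turán number `ex_3^{bip}(mA, nB, K_{t,s,s})`. -/
noncomputable def exBip (mA nB t s : ℕ) : ℕ :=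
  sSup {k | ∃ H : Finset (Finset (Fin mA ⊕ Fin nB)),
    BipShape mA nB H ∧ ¬ HasBipKtss mA nB t s H ∧ H.card = k}

/-- The `s`-set `S_0` inside the residue-0 part of `T_3(3m,3)`. -/
def S0set (m s : ℕ) (h : 2*s ≤ m) : Finset (Fin (3*m)) :=
  Finset.univ.image (fun i : Fin s => (⟨3*i.val, by have := i.isLt; omega⟩ : Fin (3*m)))

/-- The `s`-set `S_1` inside the residue-0 part of `T_3(3m,3)`, disjoint from `S_0`. -/
def S1set (m s : ℕ) (h : 2*s ≤ m) : Finset (Fin (3*m)) :=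
  Finset.univ.image (fun i : Fin s => (⟨3*(s+i.val), by have := i.isLt; omega⟩ : Fin (3*m)))

/-- The 3-graph `F_5^S(m,t,K_{s,s})`: `T_3(3m,3)` (on the `inl` vertices) together with a set
`T` of `t` new vertices (the `inr` vertices) and all triples consisting of one vertex of `T`,
one vertex of `S_0` and one vertex of `S_1`. -/
def F5Stss (m t s : ℕ) (h : 2*s ≤ m) : Finset (Finset (Fin (3*m) ⊕ Fin t)) :=
  (T3 (3*m)).image (fun e => e.image Sum.inl) ∪
  Finset.univ.biUnion (fun j : Fin t =>
    ((S0set m s h) ×ˢ (S1set m s h)).image (fun p =>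
      ({Sum.inr j, Sum.inl p.1, Sum.inl p.2} : Finset (Fin (3*m) ⊕ Fin t))))

/-- `F_sim(t)`: the 3-graph with hyperedges `f_1f_2f_3, f_1f_2f_4, f_3f_4f_5, f_5f_6f_7,
f_6f_7f_8` in which `f_8` is blown up to `t` copies. Here `inl 0, …, inl 6` play the roles
of `f_1, …, f_7` and the vertices `inr j` are the `t` copies of `f_8`. -/
def Fsim (t : ℕ) : Finset (Finset (Fin 7 ⊕ Fin t)) :=
  ({({Sum.inl 0, Sum.inl 1, Sum.inl 2} : Finset (Fin 7 ⊕ Fin t)),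
    ({Sum.inl 0, Sum.inl 1, Sum.inl 3} : Finset (Fin 7 ⊕ Fin t)),
    ({Sum.inl 2, Sum.inl 3, Sum.inl 4} : Finset (Fin 7 ⊕ Fin t)),
    ({Sum.inl 4, Sum.inl 5, Sum.inl 6} : Finset (Fin 7 ⊕ Fin t))} :
      Finset (Finset (Fin 7 ⊕ Fin t))) ∪
  Finset.univ.image (fun j : Fin t => ({Sum.inl 5, Sum.inl 6, Sum.inr j} : Finset (Fin 7 ⊕ Fin t)))

/-- The 3-graph with parts `A`, `B`, `C` and an extra clique `X`: its hyperedges are the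
triples with one vertex in each of `A`, `B`, `C`, all 3-subsets of `X`, and the triples with
one vertex in `X` and two vertices in a common part among `A`, `B`, `C`. -/
def simConstr (n : ℕ) (A B C X : Finset (Fin n)) : Finset (Finset (Fin n)) :=
  Finset.univ.filter (fun e => e.card = 3 ∧
    (((e ∩ A).card = 1 ∧ (e ∩ B).card = 1 ∧ (e ∩ C).card = 1) ∨
     e ⊆ X ∨
     ((e ∩ X).card = 1 ∧ ((e ∩ A).card = 2 ∨ (e ∩ B).card = 2 ∨ (e ∩ C).card = 2))))

/-- `F_5^S(m)`: `T_3(3m,3)` together with one new vertex `v = inr ()` and one hyperedge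
consisting of `v` and two vertices (`0` and `3`) lying in one part of `T_3(3m,3)`. -/
def F5Sm (m : ℕ) (hm : 2 ≤ m) : Finset (Finset (Fin (3*m) ⊕ Unit)) :=
  (T3 (3*m)).image (fun e => e.image Sum.inl) ∪
  {({Sum.inr (), Sum.inl ⟨0, by omega⟩, Sum.inl ⟨3, by omega⟩} : Finset (Fin (3*m) ⊕ Unit))}

/-- The disjoint union of `k` vertex-disjoint copies of the 3-graph `F`. -/
def copies (k : ℕ) {W : Type*} [DecidableEq W] (F : Finset (Finset W)) :
    Finset (Finset (Fin k × W)) :=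
  Finset.univ.biUnion (fun j : Fin k => F.image (fun e => e.image (fun w => (j, w))))

/-- The 3-graph `G(t,m,n)` (it does not depend on `m`): the vertices `v < t` form the set
`T`, the remaining `n - t` vertices carry a copy of `T_3(n-t,3)` (parts by residue of
`v - t` mod 3), and the hyperedges are those of this `T_3(n-t,3)` together with all
3-sets of vertices intersecting `T`. -/
def Gtmn (t n : ℕ) : Finset (Finset (Fin n)) :=
  Finset.univ.filter (fun e => e.card = 3 ∧
    ((∃ v ∈ e, (v : ℕ) < t) ∨
     (∀ i : Fin 3, (e.filter (fun v : Fin n => t ≤ (v : ℕ) ∧ ((v : ℕ) - t) % 3 = (i : ℕ))).card = 1)))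

/-- The blow-up of `F_5` in which every vertex is replaced by `t` copies:
the vertex `(i, j)` is the `j`-th copy of `f_{i+1}`. -/
def F5blowAll (t : ℕ) : Finset (Finset (Fin 5 × Fin t)) :=
  Finset.univ.biUnion (fun x : Fin t × Fin t × Fin t =>
    ({ ({((0:Fin 5), x.1), ((1:Fin 5), x.2.1), ((2:Fin 5), x.2.2)} : Finset (Fin 5 × Fin t)),
       ({((0:Fin 5), x.1), ((1:Fin 5), x.2.1), ((3:Fin 5), x.2.2)} : Finset (Fin 5 × Fin t)),
       ({((2:Fin 5), x.1), ((3:Fin 5), x.2.1), ((4:Fin 5), x.2.2)} : Finset (Fin 5 × Fin t)) } :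
      Finset (Finset (Fin 5 × Fin t))))

theorem mem_turanPart {n : ℕ} {i : Fin 3} {v : Fin n} :
    v ∈ turanPart n i ↔ (v : ℕ) % 3 = (i : ℕ) := by
  simp [turanPart]

/-- Two distinct vertices of an edge of `T_3(n,3)` lie in different parts. -/
theorem mod_three_ne_of_mem_T3 {n : ℕ} {e : Finset (Fin n)} (he : e ∈ T3 n) {u v : Fin n}
    (hu : u ∈ e) (hv : v ∈ e) (huv : u ≠ v) : (u : ℕ) % 3 ≠ (v : ℕ) % 3 := by
  intro h
  have hcard := (Finset.mem_filter.mp he).2.2 ⟨(u : ℕ) % 3, Nat.mod_lt _ (by norm_num)⟩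
  obtain ⟨x, hx⟩ := Finset.card_eq_one.mp hcard
  have hux : u ∈ ({x} : Finset (Fin n)) := by
    rw [← hx]
    exact Finset.mem_inter.mpr ⟨hu, mem_turanPart.mpr rfl⟩
  have hvx : v ∈ ({x} : Finset (Fin n)) := by
    rw [← hx]
    exact Finset.mem_inter.mpr ⟨hv, mem_turanPart.mpr h.symm⟩
  exact huv ((Finset.mem_singleton.mp hux).trans (Finset.mem_singleton.mp hvx).symm)

/-- If each edge of `H` is an edge of `T_3(n,3)` or lies inside a part, then the vertices of
an edge of `H` lie either all in the same part or in three different parts. -/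
theorem mod_three_eq_or_ne {n : ℕ} {H : Finset (Finset (Fin n))}
    (hedges : ∀ e ∈ H, e ∈ T3 n ∨ (e.card = 3 ∧ ∃ i : Fin 3, e ⊆ turanPart n i))
    {u v w : Fin n} (he : ({u, v, w} : Finset (Fin n)) ∈ H)
    (huv : u ≠ v) (huw : u ≠ w) (hvw : v ≠ w) :
    ((u : ℕ) % 3 = (v : ℕ) % 3 ∧ (u : ℕ) % 3 = (w : ℕ) % 3) ∨
    ((u : ℕ) % 3 ≠ (v : ℕ) % 3 ∧ (u : ℕ) % 3 ≠ (w : ℕ) % 3 ∧ (v : ℕ) % 3 ≠ (w : ℕ) % 3) := by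
  rcases hedges _ he with h | ⟨-, i, hi⟩
  · exact Or.inr ⟨mod_three_ne_of_mem_T3 h (by simp) (by simp) huv,
      mod_three_ne_of_mem_T3 h (by simp) (by simp) huw,
      mod_three_ne_of_mem_T3 h (by simp) (by simp) hvw⟩
  · have hu := mem_turanPart.mp (hi (show u ∈ _ by simp))
    have hv := mem_turanPart.mp (hi (show v ∈ _ by simp))
    have hw := mem_turanPart.mp (hi (show w ∈ _ by simp))
    exact Or.inl ⟨hu.trans hv.symm, hu.trans hw.symm⟩

/-- A pair `u, v` with `t` common neighbours, all in one part, lies in at least `t` edges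
inside that part. -/
theorem le_card_filter_edges {n t : ℕ} {H : Finset (Finset (Fin n))} {i : Fin 3} {u v : Fin n}
    (hu : u ∈ turanPart n i) (hv : v ∈ turanPart n i)
    {g : Fin t → Fin n} (hg : Function.Injective g)
    (hgu : ∀ j, g j ≠ u) (hgv : ∀ j, g j ≠ v)
    (hgi : ∀ j, g j ∈ turanPart n i)
    (hgH : ∀ j, ({u, v, g j} : Finset (Fin n)) ∈ H) :
    t ≤ (H.filter (fun e => u ∈ e ∧ v ∈ e ∧ e ⊆ turanPart n i)).card := by
  have hinj : Function.Injective (fun j => ({u, v, g j} : Finset (Fin n))) := by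
    intro j k hjk
    have hmem : g j ∈ ({u, v, g k} : Finset (Fin n)) := by
      rw [← show ({u, v, g j} : Finset (Fin n)) = {u, v, g k} from hjk]
      simp
    simp only [Finset.mem_insert, Finset.mem_singleton, hgu, hgv, false_or] at hmem
    exact hg hmem
  calc t = (Finset.univ.image (fun j => ({u, v, g j} : Finset (Fin n)))).card := by
        rw [Finset.card_image_of_injective _ hinj, Finset.card_univ, Fintype.card_fin]
    _ ≤ _ := by
        refine Finset.card_le_card (Finset.image_subset_iff.mpr fun j _ => ?_)
        refine Finset.mem_filter.mpr ⟨hgH j, by simp, by simp, ?_⟩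
        simp [Finset.insert_subset_iff, hu, hv, hgi j]

theorem statement11 (t : ℕ) (ht : 1 ≤ t) (n : ℕ)
    (H : Finset (Finset (Fin n)))
    (hsub : T3 n ⊆ H)
    (hedges : ∀ e ∈ H, e ∈ T3 n ∨ (e.card = 3 ∧ ∃ i : Fin 3, e ⊆ turanPart n i))
    (hpair : ∀ i : Fin 3, ∀ u ∈ turanPart n i, ∀ v ∈ turanPart n i, u ≠ v →
      (H.filter (fun e => u ∈ e ∧ v ∈ e ∧ e ⊆ turanPart n i)).card ≤ t - 1) :
    ¬ HasCopy H (F5b3 t) := by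
  rintro ⟨f, hf⟩
  have hne : ∀ {x y : Fin 4 ⊕ Fin t}, x ≠ y → f x ≠ f y := fun h h' => h (f.injective h')
  have habc : ({f (Sum.inl 0), f (Sum.inl 1), f (Sum.inl 2)} : Finset (Fin n)) ∈ H := by
    simpa [Finset.image_insert] using
      hf {Sum.inl 0, Sum.inl 1, Sum.inl 2} (by simp [F5b3])
  have habx : ∀ j, ({f (Sum.inl 0), f (Sum.inl 1), f (Sum.inr j)} : Finset (Fin n)) ∈ H := by
    intro j
    simpa [Finset.image_insert] using
      hf {Sum.inl 0, Sum.inl 1, Sum.inr j} (by simp [F5b3])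
  have hcdx : ∀ j, ({f (Sum.inl 2), f (Sum.inl 3), f (Sum.inr j)} : Finset (Fin n)) ∈ H := by
    intro j
    have h := hf {Sum.inr j, Sum.inl 2, Sum.inl 3} (by simp [F5b3])
    rw [Finset.image_insert, Finset.image_insert, Finset.image_singleton] at h
    convert h using 1
    ext x
    simp only [Finset.mem_insert, Finset.mem_singleton]
    tauto
  have mabc := mod_three_eq_or_ne hedges habc (hne (by simp)) (hne (by simp)) (hne (by simp))
  have mabx := fun j =>
    mod_three_eq_or_ne hedges (habx j) (hne (by simp)) (hne (by simp)) (hne (by simp))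
  have mcdx := fun j =>
    mod_three_eq_or_ne hedges (hcdx j) (hne (by simp)) (hne (by simp)) (hne (by simp))
  have hinj : Function.Injective fun j => f (Sum.inr j) :=
    f.injective.comp Sum.inr_injective
  have key : ∀ p q : Fin 4, p ≠ q →
      (f (Sum.inl p) : ℕ) % 3 = (f (Sum.inl q) : ℕ) % 3 →
      (∀ j, (f (Sum.inr j) : ℕ) % 3 = (f (Sum.inl p) : ℕ) % 3) →
      (∀ j, ({f (Sum.inl p), f (Sum.inl q), f (Sum.inr j)} : Finset (Fin n)) ∈ H) → False := by
    intro p q hpq hmod hx hmem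
    let i : Fin 3 := ⟨(f (Sum.inl p) : ℕ) % 3, Nat.mod_lt _ (by norm_num)⟩
    have hp : f (Sum.inl p) ∈ turanPart n i := mem_turanPart.mpr rfl
    have hq : f (Sum.inl q) ∈ turanPart n i := mem_turanPart.mpr hmod.symm
    have hle := hpair i _ hp _ hq (hne (by simpa using hpq))
    have hge := le_card_filter_edges hp hq hinj (fun j => hne (by simp))
      (fun j => hne (by simp)) (fun j => mem_turanPart.mpr (hx j)) hmem
    omega
  by_cases hab : (f (Sum.inl 0) : ℕ) % 3 = (f (Sum.inl 1) : ℕ) % 3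
  · refine key 0 1 (by decide) hab (fun j => ?_) habx
    have := mabx j
    omega
  · have hxc : ∀ j, (f (Sum.inr j) : ℕ) % 3 = (f (Sum.inl 2) : ℕ) % 3 := by
      intro j
      have := mabx j
      omega
    refine key 2 3 (by decide) ?_ hxc hcdx
    have h₁ := mcdx ⟨0, ht⟩
    have h₂ := hxc ⟨0, ht⟩
    omega
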